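/- Cartan decomposition for the non-symmetric reductive spherical pair (SO(7,ℂ), G_2(ℂ)) of rank-one type: for every g ∈ SO(8,ℂ) with g e_0 = e_0 (i.e. g in the realization of SO(7,ℂ)) there exist k ∈ SO(8,ℂ) with real entries and k e_0 = e_0 (i.e. k ∈ SO(7)), θ ∈ ℝ, and h ∈ G_2(ℂ) such that g = k a_θ h. That is, SO(7,ℂ) = SO(7) · A_0 · G_2(ℂ), where A_0 = {a_θ : θ ∈ ℝ}. -/

import Mathlib

open Matrix

noncomputable section

/-- The standard basis of the complexified Cayley algebra `𝕆_ℂ = ℂ^8`. -/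
def e (i : Fin 8) : Fin 8 → ℂ := Pi.single i 1

/-- The oriented lines of the multiplication table of the Cayley algebra:
`(i, j, k)` in this list means `e_i e_j = e_k`. -/
def octLines : List (Fin 8 × Fin 8 × Fin 8) :=
  [(1,2,3),(2,3,1),(3,1,2),
   (1,4,5),(4,5,1),(5,1,4),
   (1,6,7),(6,7,1),(7,1,6),
   (2,5,7),(5,7,2),(7,2,5),
   (2,6,4),(6,4,2),(4,2,6),
   (3,5,6),(5,6,3),(6,3,5),
   (3,4,7),(4,7,3),(7,3,4)]

/-- Product of two basis elements of the complexified Cayley algebra. -/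
def octBasisMul (i j : Fin 8) : Fin 8 → ℂ :=
  if i = 0 then e j
  else if j = 0 then e i
  else if i = j then -(e 0)
  else
    match octLines.find? (fun t => t.1 == i && t.2.1 == j) with
    | some t => e t.2.2
    | none =>
      match octLines.find? (fun t => t.1 == j && t.2.1 == i) with
      | some t => -(e t.2.2)
      | none => 0

/-- The bilinear multiplication of the complexified Cayley algebra `𝕆_ℂ`. -/
def octMul (x y : Fin 8 → ℂ) : Fin 8 → ℂ :=
  ∑ i, ∑ j, (x i * y j) • octBasisMul i j

/-- The standard symmetric bilinear form on `ℂ^8`. -/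
def bform (v w : Fin 8 → ℂ) : ℂ := ∑ i, v i * w i

/-- `SO(8, ℂ)`. -/
def SO8 (g : Matrix (Fin 8) (Fin 8) ℂ) : Prop := gᵀ * g = 1 ∧ g.det = 1

/-- A matrix has real entries. -/
def realMat (g : Matrix (Fin 8) (Fin 8) ℂ) : Prop := ∀ i j, (g i j).im = 0

/-- The realization of `G₂(ℂ)` as automorphisms of `𝕆_ℂ`. -/
def inG2 (g : Matrix (Fin 8) (Fin 8) ℂ) : Prop :=
  SO8 g ∧ ∀ x y, g.mulVec (octMul x y) = octMul (g.mulVec x) (g.mulVec y)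

/-- The compact real form `G₂`. -/
def inG2cpt (g : Matrix (Fin 8) (Fin 8) ℂ) : Prop := inG2 g ∧ realMat g

/-- The realization `B₃(ℂ)` of `Spin(7, ℂ)`. -/
def inB3 (g : Matrix (Fin 8) (Fin 8) ℂ) : Prop :=
  SO8 g ∧ ∃ g₀, SO8 g₀ ∧ g₀.mulVec (e 0) = e 0 ∧
    ∀ x y, octMul (g₀.mulVec x) (g.mulVec y) = g.mulVec (octMul x y)

/-- The compact real form `Spin(7)`. -/
def inSpin7 (g : Matrix (Fin 8) (Fin 8) ℂ) : Prop :=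
  SO8 g ∧ realMat g ∧ ∃ g₀, SO8 g₀ ∧ realMat g₀ ∧ g₀.mulVec (e 0) = e 0 ∧
    ∀ x y, octMul (g₀.mulVec x) (g.mulVec y) = g.mulVec (octMul x y)

/-- The one-parameter group `t_θ` (abelian slice `A₁` for `(G₂(ℂ), SL(3,ℂ))`). -/
def tmat (θ : ℝ) : Matrix (Fin 8) (Fin 8) ℂ :=
  Matrix.of fun i j =>
    (![ e 0,
        (Real.cosh θ : ℂ) • e 1 + (Complex.I * (Real.sinh θ : ℂ)) • e 2,
        (-(Complex.I * (Real.sinh θ : ℂ))) • e 1 + (Real.cosh θ : ℂ) • e 2,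
        e 3,
        (Real.cosh (θ/2) : ℂ) • e 4 + (-(Complex.I * (Real.sinh (θ/2) : ℂ))) • e 7,
        (Real.cosh (θ/2) : ℂ) • e 5 + (-(Complex.I * (Real.sinh (θ/2) : ℂ))) • e 6,
        (Complex.I * (Real.sinh (θ/2) : ℂ)) • e 5 + (Real.cosh (θ/2) : ℂ) • e 6,
        (Complex.I * (Real.sinh (θ/2) : ℂ)) • e 4 + (Real.cosh (θ/2) : ℂ) • e 7 ] j) i

/-- The generator `τ₁` of the one-parameter group `A₁`, i.e. `exp (θ τ₁) = t_θ`. -/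
def tau1 : Matrix (Fin 8) (Fin 8) ℂ :=
  Matrix.of fun i j =>
    (![ 0,
        Complex.I • e 2,
        (-Complex.I) • e 1,
        0,
        (-(Complex.I/2)) • e 7,
        (-(Complex.I/2)) • e 6,
        (Complex.I/2) • e 5,
        (Complex.I/2) • e 4 ] j) i

/-- The one-parameter group `ã_θ` (abelian slice `Ã₀` for `(Spin(7,ℂ), G₂(ℂ))`). -/
def atil (θ : ℝ) : Matrix (Fin 8) (Fin 8) ℂ :=
  Matrix.of fun i j =>
    (![ (Real.cosh θ : ℂ) • e 0 + (Complex.I * (Real.sinh θ : ℂ)) • e 1,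
        (-(Complex.I * (Real.sinh θ : ℂ))) • e 0 + (Real.cosh θ : ℂ) • e 1,
        (Real.cosh (θ/3) : ℂ) • e 2 + (-(Complex.I * (Real.sinh (θ/3) : ℂ))) • e 3,
        (Complex.I * (Real.sinh (θ/3) : ℂ)) • e 2 + (Real.cosh (θ/3) : ℂ) • e 3,
        (Real.cosh (θ/3) : ℂ) • e 4 + (-(Complex.I * (Real.sinh (θ/3) : ℂ))) • e 5,
        (Complex.I * (Real.sinh (θ/3) : ℂ)) • e 4 + (Real.cosh (θ/3) : ℂ) • e 5,
        (Real.cosh (θ/3) : ℂ) • e 6 + (-(Complex.I * (Real.sinh (θ/3) : ℂ))) • e 7,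
        (Complex.I * (Real.sinh (θ/3) : ℂ)) • e 6 + (Real.cosh (θ/3) : ℂ) • e 7 ] j) i

/-- The generator `α̃₁` of the one-parameter group `Ã₀`, i.e. `exp (θ α̃₁) = ã_θ`. -/
def alphatil1 : Matrix (Fin 8) (Fin 8) ℂ :=
  Matrix.of fun i j =>
    (![ Complex.I • e 1,
        (-Complex.I) • e 0,
        (-(Complex.I/3)) • e 3,
        (Complex.I/3) • e 2,
        (-(Complex.I/3)) • e 5,
        (Complex.I/3) • e 4,
        (-(Complex.I/3)) • e 7,
        (Complex.I/3) • e 6 ] j) i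

/-- The one-parameter group `a_x` (abelian slice `A₀` for `(SO(7,ℂ), G₂(ℂ))`). -/
def amat (x : ℝ) : Matrix (Fin 8) (Fin 8) ℂ :=
  Matrix.of fun i j =>
    (![ e 0,
        e 1,
        (Real.cosh x : ℂ) • e 2 + (Complex.I * (Real.sinh x : ℂ)) • e 3,
        (-(Complex.I * (Real.sinh x : ℂ))) • e 2 + (Real.cosh x : ℂ) • e 3,
        (Real.cosh x : ℂ) • e 4 + (Complex.I * (Real.sinh x : ℂ)) • e 5,
        (-(Complex.I * (Real.sinh x : ℂ))) • e 4 + (Real.cosh x : ℂ) • e 5,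
        (Real.cosh x : ℂ) • e 6 + (Complex.I * (Real.sinh x : ℂ)) • e 7,
        (-(Complex.I * (Real.sinh x : ℂ))) • e 6 + (Real.cosh x : ℂ) • e 7 ] j) i

/-- The matrix `I₊₋ = diag(1, −1, 1, −1, 1, −1, 1, −1)`. -/
def Ipm : Matrix (Fin 8) (Fin 8) ℂ :=
  Matrix.diagonal ![1, -1, 1, -1, 1, -1, 1, -1]

/-- The anti-holomorphic involution `σ₀(g) = I₊₋ ḡ I₊₋`. -/
def sigma0 (g : Matrix (Fin 8) (Fin 8) ℂ) : Matrix (Fin 8) (Fin 8) ℂ :=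
  Ipm * g.map (starRingEnd ℂ) * Ipm

end

/-- Left multiplication by `x` in the Cayley algebra over a commutative ring `R`. -/
def octL {R : Type*} [CommRing R] (x : Fin 8 → R) : Matrix (Fin 8) (Fin 8) R :=
  !![x 0, -x 1, -x 2, -x 3, -x 4, -x 5, -x 6, -x 7;
    x 1, x 0, -x 3, x 2, -x 5, x 4, -x 7, x 6;
    x 2, x 3, x 0, -x 1, x 6, -x 7, -x 4, x 5;
    x 3, -x 2, x 1, x 0, -x 7, -x 6, x 5, x 4;
    x 4, x 5, -x 6, x 7, x 0, -x 1, x 2, -x 3;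
    x 5, -x 4, x 7, x 6, x 1, x 0, -x 3, -x 2;
    x 6, x 7, x 4, -x 5, -x 2, x 3, x 0, -x 1;
    x 7, -x 6, -x 5, -x 4, x 3, x 2, x 1, x 0]

section CayleyLeftMul

variable {R : Type*} [CommRing R]

/-- The standard basis vectors over `R`. -/
abbrev bv (i : Fin 8) : Fin 8 → R := Pi.single i 1

theorem octL_add (x y : Fin 8 → R) : octL (x + y) = octL x + octL y := by
  ext i j
  fin_cases i <;> fin_cases j <;> simp [octL] <;> ring

theorem octL_smul (c : R) (x : Fin 8 → R) : octL (c • x) = c • octL x := by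
  ext i j
  fin_cases i <;> fin_cases j <;> simp [octL]

theorem octL_one : octL (bv 0 : Fin 8 → R) = 1 := by
  ext i j
  fin_cases i <;> fin_cases j <;> simp [octL]

theorem octL_mulVec_one (x : Fin 8 → R) : octL x *ᵥ bv 0 = x := by
  ext i
  fin_cases i <;> simp [octL]

theorem octL_transpose (x : Fin 8 → R) : (octL x)ᵀ = (2 * x 0) • (1 : Matrix _ _ R) - octL x := by
  ext i j
  fin_cases i <;> fin_cases j <;> simp [octL] <;> ring

set_option maxHeartbeats 2000000 in
theorem octL_clifford (x y : Fin 8 → R) :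
    (octL x)ᵀ * octL y + (octL y)ᵀ * octL x = (2 * (x ⬝ᵥ y)) • (1 : Matrix _ _ R) := by
  ext i j
  fin_cases i <;> fin_cases j <;>
    simp [octL, Matrix.mul_apply, Fin.sum_univ_eight, dotProduct] <;> ring

end CayleyLeftMul

theorem octBasisMul_eq (i j : Fin 8) : octBasisMul i j = octL (bv i) *ᵥ bv j := by
  ext k
  fin_cases i <;> fin_cases j <;> simp [octBasisMul, octLines, e, octL] <;> fin_cases k <;> simp

theorem octL_eq_sum {R : Type*} [CommRing R] (x : Fin 8 → R) :
    octL x = ∑ i, x i • octL (bv i) := by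
  let f : (Fin 8 → R) →ₗ[R] Matrix (Fin 8) (Fin 8) R :=
    { toFun := octL, map_add' := octL_add, map_smul' := octL_smul }
  have h : x = ∑ i, x i • (bv i : Fin 8 → R) := by
    ext k
    simp [Finset.sum_apply, Pi.single_apply]
  calc octL x = f (∑ i, x i • bv i) := by rw [← h]; rfl
    _ = ∑ i, x i • octL (bv i) := by rw [map_sum]; simp only [map_smul]; rfl

theorem octMul_eq (x y : Fin 8 → ℂ) : octMul x y = octL x *ᵥ y := by
  ext k
  simp only [octMul, octBasisMul_eq, mulVec_single_one, Finset.sum_apply, Pi.smul_apply,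
    smul_eq_mul, Matrix.col_apply]
  rw [octL_eq_sum x]
  simp only [mulVec, dotProduct, Matrix.sum_apply, Matrix.smul_apply, smul_eq_mul, Finset.sum_mul]
  rw [Finset.sum_comm]
  refine Finset.sum_congr rfl fun j _ => Finset.sum_congr rfl fun i _ => by ring

section SpinLift

variable {R : Type*} [CommRing R]

theorem octL_mul_add_mul {v : Fin 8 → R} (hv : v 0 = 0) (x : Fin 8 → R) :
    octL x * octL v + octL v * octL x
      = (2 * x 0) • octL v - (2 * (v ⬝ᵥ x)) • (1 : Matrix _ _ R) := by
  have h := octL_clifford v x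
  simp only [octL_transpose, hv, mul_zero, zero_smul, zero_sub, Matrix.sub_mul, Matrix.neg_mul,
    Matrix.smul_mul, Matrix.one_mul] at h
  rw [← h]
  abel

theorem octL_mul_self {v : Fin 8 → R} (hv : v 0 = 0) :
    octL v * octL v = (-(v ⬝ᵥ v)) • (1 : Matrix _ _ R) := by
  ext i j
  fin_cases i <;> fin_cases j <;>
    simp [octL, Matrix.mul_apply, Fin.sum_univ_eight, dotProduct, hv] <;> ring

theorem octL_mulVec_self {v : Fin 8 → R} (hv : v 0 = 0) (hv1 : v ⬝ᵥ v = 1) :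
    octL v *ᵥ v = -bv 0 := by
  conv_lhs => rw [← octL_mulVec_one v, mulVec_mulVec]
  rw [octL_mulVec_one, octL_mul_self hv, hv1, neg_smul, one_smul, neg_mulVec, one_mulVec]

theorem octL_mulVec_octL {v : Fin 8 → R} (hv : v 0 = 0) (hv1 : v ⬝ᵥ v = 1) (x : Fin 8 → R) :
    octL v *ᵥ octL v *ᵥ x = -x := by
  rw [mulVec_mulVec, octL_mul_self hv, hv1, neg_smul, one_smul, neg_mulVec, one_mulVec]

theorem octL_mulVec_anticomm {u v : Fin 8 → R} (hu : u 0 = 0) (hv : v 0 = 0) (huv : u ⬝ᵥ v = 0)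
    (x : Fin 8 → R) : octL u *ᵥ octL v *ᵥ x = -(octL v *ᵥ octL u *ᵥ x) := by
  have h := octL_mul_add_mul hu v
  rw [huv, hv] at h
  simp only [mul_zero, zero_smul, sub_zero] at h
  rw [mulVec_mulVec, mulVec_mulVec, eq_neg_iff_add_eq_zero, add_comm, ← add_mulVec, h, zero_mulVec]

theorem octL_mulVec_comm {u v : Fin 8 → R} (hu : u 0 = 0) (hv : v 0 = 0) (huv : u ⬝ᵥ v = 0) :
    octL u *ᵥ v = -(octL v *ᵥ u) := by
  have h := octL_mulVec_anticomm hu hv huv (bv 0)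
  rwa [octL_mulVec_one, octL_mulVec_one] at h

theorem octL_mulVec_dotProduct {v : Fin 8 → R} (hv : v 0 = 0) (x y : Fin 8 → R) :
    (octL v *ᵥ x) ⬝ᵥ y = -(x ⬝ᵥ (octL v *ᵥ y)) := by
  have h : (octL v)ᵀ = -octL v := by rw [octL_transpose, hv]; simp
  rw [dotProduct_comm, dotProduct_mulVec, ← mulVec_transpose, h, neg_mulVec, neg_dotProduct,
    dotProduct_comm]

theorem octL_orthogonal {v : Fin 8 → R} (hv : v 0 = 0) (hv1 : v ⬝ᵥ v = 1) :
    (octL v)ᵀ * octL v = 1 := by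
  have h : (octL v)ᵀ = -octL v := by rw [octL_transpose, hv]; simp
  rw [h, Matrix.neg_mul, octL_mul_self hv, hv1, neg_smul, one_smul, neg_neg]

theorem mulVec_dotProduct_mulVec {p : Matrix (Fin 8) (Fin 8) R} (hp : pᵀ * p = 1)
    (x y : Fin 8 → R) : (p *ᵥ x) ⬝ᵥ (p *ᵥ y) = x ⬝ᵥ y := by
  rw [dotProduct_mulVec, ← mulVec_transpose, mulVec_mulVec, hp, one_mulVec]

/-- The reflection in the hyperplane orthogonal to a unit vector `v`. -/
def unitRefl (v : Fin 8 → R) : Matrix (Fin 8) (Fin 8) R := 1 - (2 : R) • vecMulVec v v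

theorem unitRefl_mulVec (v x : Fin 8 → R) :
    unitRefl v *ᵥ x = x - (2 * (v ⬝ᵥ x)) • v := by
  rw [unitRefl, sub_mulVec, one_mulVec, smul_mulVec, vecMulVec_mulVec]
  ext i
  simp
  ring

theorem unitRefl_transpose (v : Fin 8 → R) : (unitRefl v)ᵀ = unitRefl v := by
  rw [unitRefl, transpose_sub, transpose_one, transpose_smul, transpose_vecMulVec]

theorem unitRefl_mul_self {v : Fin 8 → R} (hv1 : v ⬝ᵥ v = 1) : unitRefl v * unitRefl v = 1 := by
  refine Matrix.ext_of_mulVec_single fun i => ?_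
  rw [← mulVec_mulVec, unitRefl_mulVec, unitRefl_mulVec, one_mulVec, dotProduct_sub,
    dotProduct_smul, hv1]
  ext j
  simp
  ring

theorem unitRefl_det {v : Fin 8 → R} (hv1 : v ⬝ᵥ v = 1) : (unitRefl v).det = -1 := by
  have h : unitRefl v = 1 + vecMulVec ((-2 : R) • v) v := by
    rw [unitRefl, smul_vecMulVec, neg_smul, sub_eq_add_neg]
  rw [h, vecMulVec_eq Unit, det_one_add_replicateCol_mul_replicateRow, dotProduct_smul, hv1]
  norm_num

/-- The matrix of Cayley conjugation, `e_0 ↦ e_0`, `e_i ↦ -e_i`. -/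
def octConj : Matrix (Fin 8) (Fin 8) R := -unitRefl (bv 0)

theorem bv_dotProduct_self (i : Fin 8) : (bv i : Fin 8 → R) ⬝ᵥ bv i = 1 := by simp

theorem octConj_mul_self : (octConj : Matrix (Fin 8) (Fin 8) R) * octConj = 1 := by
  rw [octConj, neg_mul_neg, unitRefl_mul_self (bv_dotProduct_self 0)]

theorem octConj_transpose : (octConj : Matrix (Fin 8) (Fin 8) R)ᵀ = octConj := by
  rw [octConj, transpose_neg, unitRefl_transpose]

theorem octConj_det : (octConj : Matrix (Fin 8) (Fin 8) R).det = -1 := by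
  rw [octConj, det_neg, unitRefl_det (bv_dotProduct_self 0)]
  simp; norm_num

theorem octConj_mulVec (x : Fin 8 → R) : octConj *ᵥ x = (2 * x 0) • bv 0 - x := by
  rw [octConj, neg_mulVec, unitRefl_mulVec, neg_sub, single_one_dotProduct]

theorem octConj_mul_unitRefl {v : Fin 8 → R} (hv : v 0 = 0) :
    octConj * unitRefl v = unitRefl v * octConj := by
  refine Matrix.ext_of_mulVec_single fun i => ?_
  rw [← mulVec_mulVec, ← mulVec_mulVec, octConj_mulVec, octConj_mulVec, unitRefl_mulVec,
    unitRefl_mulVec]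
  ext j
  simp [hv, dotProduct_sub]
  ring

/-- `p` is an orthogonal matrix lifting `g`, an element of `SO(7)`, to the spin group acting on
the Cayley algebra. -/
structure IsSpinLift (g p : Matrix (Fin 8) (Fin 8) R) : Prop where
  orth : gᵀ * g = 1
  det : g.det = 1
  fix : g *ᵥ bv 0 = bv 0
  lift_orth : pᵀ * p = 1
  comm : ∀ x, octL (g *ᵥ x) * p = p * octL x

theorem IsSpinLift.one : IsSpinLift (1 : Matrix (Fin 8) (Fin 8) R) 1 :=
  ⟨by simp, by simp, one_mulVec _, by simp, by simp⟩

theorem IsSpinLift.mul {g g' p p' : Matrix (Fin 8) (Fin 8) R} (h : IsSpinLift g p)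
    (h' : IsSpinLift g' p') : IsSpinLift (g * g') (p * p') where
  orth := by rw [transpose_mul, Matrix.mul_assoc, ← Matrix.mul_assoc gᵀ, h.orth, Matrix.one_mul,
    h'.orth]
  det := by rw [det_mul, h.det, h'.det, one_mul]
  fix := by rw [← mulVec_mulVec, h'.fix, h.fix]
  lift_orth := by rw [transpose_mul, Matrix.mul_assoc, ← Matrix.mul_assoc pᵀ, h.lift_orth,
    Matrix.one_mul, h'.lift_orth]
  comm x := by rw [← mulVec_mulVec, ← Matrix.mul_assoc, h.comm, Matrix.mul_assoc, h'.comm,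
    Matrix.mul_assoc]

theorem IsSpinLift.neg {g p : Matrix (Fin 8) (Fin 8) R} (h : IsSpinLift g p) :
    IsSpinLift g (-p) where
  orth := h.orth
  det := h.det
  fix := h.fix
  lift_orth := by rw [transpose_neg, neg_mul_neg, h.lift_orth]
  comm x := by rw [Matrix.mul_neg, h.comm, Matrix.neg_mul]

theorem IsSpinLift.transpose {g p : Matrix (Fin 8) (Fin 8) R} (h : IsSpinLift g p) :
    IsSpinLift gᵀ pᵀ where
  orth := by rw [transpose_transpose, mul_eq_one_comm, h.orth]
  det := by rw [det_transpose, h.det]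
  fix := by rw [← h.fix, mulVec_mulVec, h.orth, one_mulVec, h.fix]
  lift_orth := by rw [transpose_transpose, mul_eq_one_comm, h.lift_orth]
  comm x := by
    have h1 := h.comm (gᵀ *ᵥ x)
    rw [mulVec_mulVec, mul_eq_one_comm.1 h.orth, one_mulVec] at h1
    calc octL (gᵀ *ᵥ x) * pᵀ = pᵀ * (p * octL (gᵀ *ᵥ x)) * pᵀ := by
          rw [← Matrix.mul_assoc pᵀ, h.lift_orth, Matrix.one_mul]
      _ = pᵀ * octL x := by
          rw [← h1, Matrix.mul_assoc, Matrix.mul_assoc, mul_eq_one_comm.1 h.lift_orth,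
            Matrix.mul_one]

theorem IsSpinLift.map {S : Type*} [CommRing S] (f : R →+* S) {g p : Matrix (Fin 8) (Fin 8) R}
    (h : IsSpinLift g p) : IsSpinLift (g.map f) (p.map f) where
  orth := by rw [← transpose_map, ← Matrix.map_mul, h.orth]; simp
  det := by
    have := (RingHom.map_det f g).symm
    rwa [h.det, map_one] at this
  fix := by
    ext i
    have := congrArg f (congrFun h.fix i)
    simpa [Pi.single_apply, apply_ite f] using this
  lift_orth := by rw [← transpose_map, ← Matrix.map_mul, h.lift_orth]; simp
  comm x := by
    have hL : ∀ y : Fin 8 → R, octL (f ∘ y) = (octL y).map f := by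
      intro y
      ext i j
      fin_cases i <;> fin_cases j <;> simp [octL]
    have hb : ∀ i, octL ((g.map f) *ᵥ bv i) * p.map f = p.map f * octL (bv i) := by
      intro i
      have h1 : (bv i : Fin 8 → S) = f ∘ bv i := by
        ext j
        simp [Pi.single_apply, apply_ite f]
      have h2 : g.map f *ᵥ (f ∘ bv i) = f ∘ (g *ᵥ bv i) := by
        ext j
        exact (RingHom.map_mulVec f g (bv i) j).symm
      rw [h1, h2, hL, hL, ← Matrix.map_mul, ← Matrix.map_mul, h.comm]
    let F : (Fin 8 → S) →ₗ[S] Matrix (Fin 8) (Fin 8) S :=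
      { toFun := fun y => octL ((g.map f) *ᵥ y) * p.map f - p.map f * octL y
        map_add' := fun y z => by
          simp only [mulVec_add, octL_add, Matrix.mul_add, Matrix.add_mul]
          abel
        map_smul' := fun c y => by
          simp only [mulVec_smul, octL_smul, Matrix.smul_mul, Matrix.mul_smul, smul_sub,
            RingHom.id_apply] }
    have hF : F = 0 := by
      refine LinearMap.pi_ext' fun i => LinearMap.ext_ring ?_
      exact sub_eq_zero.2 (hb i)
    exact sub_eq_zero.1 (LinearMap.congr_fun hF x)

theorem isSpinLift_octL {v : Fin 8 → R} (hv : v 0 = 0) (hv1 : v ⬝ᵥ v = 1) :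
    IsSpinLift (unitRefl v * octConj) (octL v) where
  orth := by
    rw [transpose_mul, octConj_transpose, unitRefl_transpose, Matrix.mul_assoc,
      ← Matrix.mul_assoc (unitRefl v), unitRefl_mul_self hv1, Matrix.one_mul, octConj_mul_self]
  det := by rw [det_mul, unitRefl_det hv1, octConj_det]; norm_num
  fix := by
    rw [← mulVec_mulVec, octConj_mulVec, unitRefl_mulVec]
    ext i
    simp [dotProduct_sub, hv]
    ring
  lift_orth := octL_orthogonal hv hv1
  comm x := by
    have h1 : (unitRefl v * octConj) *ᵥ x
        = (2 * (v ⬝ᵥ x)) • v + (2 * x 0) • bv 0 + (-1 : R) • x := by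
      rw [← mulVec_mulVec, octConj_mulVec, unitRefl_mulVec]
      ext i
      simp [dotProduct_sub, hv]
      ring
    have h2 := octL_mul_add_mul hv x
    rw [← eq_sub_iff_add_eq'] at h2
    rw [h1, octL_add, octL_add, octL_smul, octL_smul, octL_smul, octL_one, Matrix.add_mul,
      Matrix.add_mul, smul_mul, smul_mul, smul_mul, Matrix.one_mul, octL_mul_self hv, hv1, h2]
    simp only [neg_smul, one_smul, smul_neg]
    abel

end SpinLift

section ComplexLift

theorem exists_isSpinLift_of_unitRefl_mul {g : Matrix (Fin 8) (Fin 8) ℂ} {w : Fin 8 → ℂ}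
    (hw : w 0 = 0) (hw1 : w ⬝ᵥ w = 1)
    (h : ∃ p, IsSpinLift (unitRefl w * g) p ∨ IsSpinLift (octConj * (unitRefl w * g)) p) :
    ∃ p, IsSpinLift g p ∨ IsSpinLift (octConj * g) p := by
  have hs := isSpinLift_octL hw hw1
  obtain ⟨p, h | h⟩ := h
  · refine ⟨octL w * p, Or.inr ?_⟩
    have := hs.mul h
    rwa [← octConj_mul_unitRefl hw, Matrix.mul_assoc, ← Matrix.mul_assoc (unitRefl w),
      unitRefl_mul_self hw1, Matrix.one_mul] at this
  · refine ⟨octL w * p, Or.inl ?_⟩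
    have := hs.mul h
    rwa [Matrix.mul_assoc, ← Matrix.mul_assoc octConj, octConj_mul_self, Matrix.one_mul,
      ← Matrix.mul_assoc, unitRefl_mul_self hw1, Matrix.one_mul] at this

theorem exists_unit_smul {d : Fin 8 → ℂ} (hd : d ⬝ᵥ d ≠ 0) :
    ∃ (c : ℂ) (w : Fin 8 → ℂ), w ⬝ᵥ w = 1 ∧ d = c • w := by
  obtain ⟨c, hc⟩ := IsAlgClosed.exists_pow_nat_eq (d ⬝ᵥ d) (n := 2) (by norm_num)
  have hc0 : c ≠ 0 := by
    rintro rfl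
    exact hd (by rw [← hc]; norm_num)
  refine ⟨c, c⁻¹ • d, ?_, ?_⟩
  · rw [dotProduct_smul, smul_dotProduct, ← hc]
    simp only [smul_eq_mul]
    field_simp
  · rw [smul_smul, mul_inv_cancel₀ hc0, one_smul]

theorem exists_isSpinLift_or (n : ℕ) : ∀ (g : Matrix (Fin 8) (Fin 8) ℂ), gᵀ * g = 1 →
    g *ᵥ bv 0 = bv 0 → (∀ j : Fin 8, j.val + n < 8 → g *ᵥ bv j = bv j) →
    ∃ p, IsSpinLift g p ∨ IsSpinLift (octConj * g) p := by
  induction n with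
  | zero =>
    intro g _ _ h
    have : g = 1 := Matrix.ext_of_mulVec_single fun i => by
      rw [one_mulVec, h i (by omega)]
    exact ⟨1, Or.inl (this ▸ IsSpinLift.one)⟩
  | succ n ih =>
    intro g hg hg0 h
    by_cases hn : 7 ≤ n
    · refine ih g hg hg0 fun j hj => ?_
      have : j = 0 := by ext; simp; omega
      rw [this, hg0]
    push Not at hn
    set i : Fin 8 := ⟨7 - n, by omega⟩ with hi
    set v := g *ᵥ bv i with hv
    have hi0 : i ≠ 0 := by
      intro h0
      have := congrArg Fin.val h0
      simp [hi] at this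
      omega
    have hvv : v ⬝ᵥ v = 1 := by rw [hv, mulVec_dotProduct_mulVec hg, bv_dotProduct_self]
    -- the vectors already fixed are orthogonal to both `bv i` and `v`
    have horth : ∀ j : Fin 8, j.val + (n + 1) < 8 → j ≠ i ∧ v j = 0 := by
      intro j hj
      have hji : j ≠ i := by
        intro h0
        have := congrArg Fin.val h0
        simp [hi] at this
        omega
      refine ⟨hji, ?_⟩
      have h1 := mulVec_dotProduct_mulVec hg (bv j) (bv i)
      rw [h j hj, ← hv] at h1
      simpa [hji] using h1
    have hv0 : v 0 = 0 := (horth 0 (by simp; omega)).2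
    have key : ∀ k : Matrix (Fin 8) (Fin 8) ℂ, kᵀ * k = 1 → k *ᵥ v = bv i →
        (∀ j : Fin 8, j ≠ i → v j = 0 → k *ᵥ bv j = bv j) →
        ∃ p, IsSpinLift (k * g) p ∨ IsSpinLift (octConj * (k * g)) p := by
      intro k hk hkv hkj
      refine ih _ ?_ ?_ ?_
      · rw [transpose_mul, Matrix.mul_assoc, ← Matrix.mul_assoc kᵀ, hk, Matrix.one_mul, hg]
      · rw [← mulVec_mulVec, hg0, hkj 0 hi0.symm hv0]
      · intro j hj
        rw [← mulVec_mulVec]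
        by_cases hji : j = i
        · rw [hji, ← hv, hkv]
        · have : j.val + (n + 1) < 8 := by
            have : j.val ≠ 7 - n := fun h0 => hji (Fin.ext h0)
            omega
          rw [h j this, hkj j hji (horth j this).2]
    by_cases hd : (v - bv i) ⬝ᵥ (v - bv i) = 0
    · have hs : (v + bv i) ⬝ᵥ (v + bv i) ≠ 0 := by
        intro hs
        have h1 : (v - bv i) ⬝ᵥ (v - bv i) + (v + bv i) ⬝ᵥ (v + bv i) = 4 := by
          simp only [dotProduct_add, dotProduct_sub, add_dotProduct, sub_dotProduct, hvv,
            bv_dotProduct_self]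
          ring
        rw [hd, hs] at h1
        norm_num at h1
      obtain ⟨c, w, hw1, hw⟩ := exists_unit_smul hs
      have hc0 : c ≠ 0 := by
        rintro rfl
        rw [hw] at hs
        simp at hs
      have hwj : ∀ j : Fin 8, j ≠ i → v j = 0 → w j = 0 := by
        intro j hji hvj
        have := congrFun hw j
        simpa [hji, hvj, hc0] using this.symm
      have hwv : unitRefl w *ᵥ v = -bv i := by
        have h1 : c * (2 * (w ⬝ᵥ v)) = c * c := by
          have h2 : (c • w) ⬝ᵥ v = 1 + bv i ⬝ᵥ v := by rw [← hw, add_dotProduct, hvv]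
          have h3 : (c • w) ⬝ᵥ (c • w) = 2 + 2 * (bv i ⬝ᵥ v) := by
            rw [← hw, dotProduct_add, add_dotProduct, add_dotProduct, hvv, bv_dotProduct_self,
              dotProduct_comm v (bv i)]
            ring
          simp only [smul_dotProduct, dotProduct_smul, smul_eq_mul, hw1] at h2 h3
          linear_combination 2 * h2 - h3
        rw [unitRefl_mulVec, mul_left_cancel₀ hc0 h1, ← hw]
        abel
      have hbi : (bv i : Fin 8 → ℂ) 0 = 0 := by simp [hi0.symm]
      refine exists_isSpinLift_of_unitRefl_mul (hwj 0 hi0.symm hv0) hw1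
        (exists_isSpinLift_of_unitRefl_mul hbi (bv_dotProduct_self i) ?_)
      rw [← Matrix.mul_assoc]
      refine key _ ?_ ?_ ?_
      · rw [transpose_mul, unitRefl_transpose, unitRefl_transpose, Matrix.mul_assoc,
          ← Matrix.mul_assoc (unitRefl (bv i)), unitRefl_mul_self (bv_dotProduct_self i),
          Matrix.one_mul, unitRefl_mul_self hw1]
      · rw [← mulVec_mulVec, hwv, unitRefl_mulVec, dotProduct_neg, bv_dotProduct_self]
        ext j
        simp
        ring
      · intro j hji hvj
        rw [← mulVec_mulVec, unitRefl_mulVec, unitRefl_mulVec, dotProduct_single_one,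
          hwj j hji hvj]
        ext l
        simp [hji]
    · obtain ⟨c, w, hw1, hw⟩ := exists_unit_smul hd
      have hc0 : c ≠ 0 := by
        rintro rfl
        rw [hw] at hd
        simp at hd
      have hwj : ∀ j : Fin 8, j ≠ i → v j = 0 → w j = 0 := by
        intro j hji hvj
        have := congrFun hw j
        simpa [hji, hvj, hc0] using this.symm
      have hwv : unitRefl w *ᵥ v = bv i := by
        have h1 : c * (2 * (w ⬝ᵥ v)) = c * c := by
          have h2 : (c • w) ⬝ᵥ v = 1 - bv i ⬝ᵥ v := by rw [← hw, sub_dotProduct, hvv]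
          have h3 : (c • w) ⬝ᵥ (c • w) = 2 - 2 * (bv i ⬝ᵥ v) := by
            rw [← hw, dotProduct_sub, sub_dotProduct, sub_dotProduct, hvv, bv_dotProduct_self,
              dotProduct_comm v (bv i)]
            ring
          simp only [smul_dotProduct, dotProduct_smul, smul_eq_mul, hw1] at h2 h3
          linear_combination 2 * h2 - h3
        rw [unitRefl_mulVec, mul_left_cancel₀ hc0 h1, ← hw]
        abel
      refine exists_isSpinLift_of_unitRefl_mul (hwj 0 hi0.symm hv0) hw1 (key _ ?_ hwv ?_)
      · rw [unitRefl_transpose, unitRefl_mul_self hw1]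
      · intro j hji hvj
        rw [unitRefl_mulVec, dotProduct_single_one, hwj j hji hvj]
        simp

/-- Every element of `SO(7, ℂ)` has a spin lift. -/
theorem exists_isSpinLift {g : Matrix (Fin 8) (Fin 8) ℂ} (hg : gᵀ * g = 1) (hdet : g.det = 1)
    (hg0 : g *ᵥ bv 0 = bv 0) : ∃ p, IsSpinLift g p := by
  obtain ⟨p, h | h⟩ := exists_isSpinLift_or 8 g hg hg0 fun j hj => absurd hj (by omega)
  · exact ⟨p, h⟩
  · have := h.det
    rw [det_mul, octConj_det, hdet] at this
    norm_num at this

end ComplexLift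

section RealLift

theorem exists_unit_orthogonal (u : Fin 4 → Fin 8 → ℝ) :
    ∃ b : Fin 8 → ℝ, b ⬝ᵥ b = 1 ∧ ∀ i, u i ⬝ᵥ b = 0 := by
  have hker : LinearMap.ker (Matrix.mulVecLin (Matrix.of u)) ≠ ⊥ :=
    LinearMap.ker_ne_bot_of_finrank_lt (by simp)
  obtain ⟨b, hb, hb0⟩ := Submodule.exists_mem_ne_zero_of_ne_bot hker
  have hbb : 0 < b ⬝ᵥ b :=
    lt_of_le_of_ne (by simpa using dotProduct_star_self_nonneg b)
      (Ne.symm (mt dotProduct_self_eq_zero.1 hb0))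
  refine ⟨(√(b ⬝ᵥ b))⁻¹ • b, ?_, fun i => ?_⟩
  · rw [dotProduct_smul, smul_dotProduct, smul_eq_mul, smul_eq_mul, ← mul_assoc, ← mul_inv,
      Real.mul_self_sqrt hbb.le, inv_mul_cancel₀ hbb.ne']
  · rw [dotProduct_smul]
    have : u i ⬝ᵥ b = 0 := congrFun (LinearMap.mem_ker.1 hb) i
    rw [this, smul_zero]

/-- The real spin group acts transitively on the unit sphere. -/
theorem exists_isSpinLift_mulVec_eq_one {u : Fin 8 → ℝ} (hu : u ⬝ᵥ u = 1) :
    ∃ k q : Matrix (Fin 8) (Fin 8) ℝ, IsSpinLift k q ∧ q *ᵥ u = bv 0 := by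
  obtain ⟨v, hv1, hv⟩ := exists_unit_orthogonal ![bv 0, u, 0, 0]
  have hv0 : v 0 = 0 := by simpa using hv 0
  have hvu : u ⬝ᵥ v = 0 := by simpa using hv 1
  have hw0 : (octL v *ᵥ u) 0 = 0 := by
    have h := octL_mulVec_dotProduct hv0 u (bv 0)
    rw [octL_mulVec_one, hvu, dotProduct_single_one, neg_zero] at h
    exact h
  have hw1 : (octL v *ᵥ u) ⬝ᵥ (octL v *ᵥ u) = 1 := by
    rw [mulVec_dotProduct_mulVec (octL_orthogonal hv0 hv1), hu]
  refine ⟨_, _, ((isSpinLift_octL hw0 hw1).mul (isSpinLift_octL hv0 hv1)).neg, ?_⟩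
  rw [neg_mulVec, ← mulVec_mulVec, octL_mulVec_self hw0 hw1, neg_neg]

/-- The stabilizer of `e_0` in the real spin group acts transitively on imaginary spheres. -/
theorem exists_isSpinLift_mulVec_eq_smul {y : Fin 8 → ℝ} (hy : y 0 = 0) :
    ∃ k q : Matrix (Fin 8) (Fin 8) ℝ, IsSpinLift k q ∧ q *ᵥ bv 0 = bv 0 ∧
      q *ᵥ y = √(y ⬝ᵥ y) • bv 1 := by
  set ρ := √(y ⬝ᵥ y) with hρ
  have hyy : y ⬝ᵥ y = ρ * ρ :=
    (Real.mul_self_sqrt (by simpa using dotProduct_star_self_nonneg y)).symm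
  set d := y - ρ • bv 1 with hd
  set m := y + ρ • bv 1 with hm
  have hd0 : d 0 = 0 := by simp [hd, hy]
  have hm0 : m 0 = 0 := by simp [hm, hy]
  have hmd : d ⬝ᵥ m = 0 := by
    rw [hd, hm, sub_dotProduct, dotProduct_add, dotProduct_add, hyy, smul_dotProduct,
      smul_dotProduct, dotProduct_smul, dotProduct_smul, bv_dotProduct_self, dotProduct_comm y]
    simp
    ring
  obtain ⟨a, r, ha1, ha0, hda, har⟩ : ∃ (a : Fin 8 → ℝ) (r : ℝ), a ⬝ᵥ a = 1 ∧ a 0 = 0 ∧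
      d ⬝ᵥ a = 0 ∧ m = r • a := by
    by_cases hmz : m = 0
    · obtain ⟨a, ha1, ha⟩ := exists_unit_orthogonal ![bv 0, d, 0, 0]
      exact ⟨a, 0, ha1, by simpa using ha 0, by simpa using ha 1, by simp [hmz]⟩
    · have hmm : 0 < m ⬝ᵥ m :=
        lt_of_le_of_ne (by simpa using dotProduct_star_self_nonneg m)
          (Ne.symm (mt dotProduct_self_eq_zero.1 hmz))
      refine ⟨(√(m ⬝ᵥ m))⁻¹ • m, √(m ⬝ᵥ m), ?_, by simp [hm0], by simp [hmd], ?_⟩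
      · rw [dotProduct_smul, smul_dotProduct, smul_eq_mul, smul_eq_mul, ← mul_assoc, ← mul_inv,
          Real.mul_self_sqrt hmm.le, inv_mul_cancel₀ hmm.ne']
      · rw [smul_smul, mul_inv_cancel₀ (Real.sqrt_pos.2 hmm).ne', one_smul]
  obtain ⟨b, hb1, hb⟩ := exists_unit_orthogonal ![bv 0, a, d, octL a *ᵥ d]
  have hb0 : b 0 = 0 := by simpa using hb 0
  have hab : a ⬝ᵥ b = 0 := hb 1
  have hdb : d ⬝ᵥ b = 0 := hb 2
  have hadb : (octL a *ᵥ d) ⬝ᵥ b = 0 := hb 3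
  set c := octL a *ᵥ b with hc
  have hc0 : c 0 = 0 := by
    have h := octL_mulVec_dotProduct ha0 b (bv 0)
    rw [octL_mulVec_one, dotProduct_comm b, hab, dotProduct_single_one, neg_zero] at h
    exact h
  have hc1 : c ⬝ᵥ c = 1 := by rw [hc, mulVec_dotProduct_mulVec (octL_orthogonal ha0 ha1), hb1]
  have hca : c ⬝ᵥ a = 0 := by
    rw [hc, octL_mulVec_dotProduct ha0, octL_mulVec_self ha0 ha1, dotProduct_neg,
      dotProduct_single_one, hb0]
    simp
  have hcd : c ⬝ᵥ d = 0 := by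
    rw [hc, octL_mulVec_dotProduct ha0, dotProduct_comm, hadb, neg_zero]
  have hbc : octL b *ᵥ c = a := by
    rw [hc, octL_mulVec_anticomm hb0 ha0 (by rw [dotProduct_comm, hab]), octL_mulVec_self hb0 hb1,
      mulVec_neg, octL_mulVec_one, neg_neg]
  refine ⟨_, -(octL a * octL b * octL c), (((isSpinLift_octL ha0 ha1).mul
    (isSpinLift_octL hb0 hb1)).mul (isSpinLift_octL hc0 hc1)).neg, ?_, ?_⟩
  · rw [neg_mulVec, ← mulVec_mulVec, ← mulVec_mulVec, octL_mulVec_one, hbc,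
      octL_mulVec_self ha0 ha1, neg_neg]
  · set q := -(octL a * octL b * octL c) with hq
    have hqa : q *ᵥ a = a := by
      rw [hq, neg_mulVec, ← mulVec_mulVec, ← mulVec_mulVec, octL_mulVec_comm hc0 ha0 hca, hc,
        octL_mulVec_octL ha0 ha1, neg_neg, octL_mulVec_self hb0 hb1, mulVec_neg, octL_mulVec_one,
        neg_neg]
    have hqd : q *ᵥ d = -d := by
      have h1 : octL c *ᵥ d = -(octL a *ᵥ octL b *ᵥ d) := by
        rw [octL_mulVec_comm hc0 hd0 hcd, hc, octL_mulVec_anticomm hd0 ha0 hda,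
          octL_mulVec_comm hd0 hb0 hdb, mulVec_neg, neg_neg]
      rw [hq, neg_mulVec, ← mulVec_mulVec, ← mulVec_mulVec, h1, mulVec_neg,
        octL_mulVec_anticomm hb0 ha0 (by rw [dotProduct_comm, hab]),
        octL_mulVec_octL hb0 hb1, mulVec_neg, neg_neg, mulVec_neg, octL_mulVec_octL ha0 ha1,
        neg_neg]
    have hy2 : y = (1 / 2 : ℝ) • (m + d) := by
      rw [hm, hd]
      ext i
      simp
      ring
    have hqm : q *ᵥ m = m := by rw [har, mulVec_smul, hqa]
    rw [hy2, mulVec_smul, mulVec_add, hqm, hqd, hm, hd]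
    ext i
    simp
    ring

end RealLift

section PlaneRotation

/-- A complex rotation in the plane of two orthonormal imaginary units `u`, `v` with `u v = e_1`,
together with a spin lift and its action on the span of `e_0` and `e_1`. -/
theorem exists_isSpinLift_plane {u v : Fin 8 → ℂ} (hu : u 0 = 0) (hv : v 0 = 0)
    (hu1 : u ⬝ᵥ u = 1) (hv1 : v ⬝ᵥ v = 1) (huv : u ⬝ᵥ v = 0) (h1 : octL u *ᵥ v = bv 1)
    {c s : ℂ} (hcs : c ^ 2 - s ^ 2 = 1) :
    ∃ k p, IsSpinLift k p ∧
      (∀ x, k *ᵥ x = x + (u ⬝ᵥ x) • ((2 * s ^ 2) • u + (2 * Complex.I * s * c) • v)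
        + (v ⬝ᵥ x) • ((2 * s ^ 2) • v - (2 * Complex.I * s * c) • u)) ∧
      p *ᵥ bv 0 = c • bv 0 + (Complex.I * s) • bv 1 ∧
      p *ᵥ bv 1 = c • bv 1 - (Complex.I * s) • bv 0 := by
  set w := c • u + (Complex.I * s) • v with hw
  have hw0 : w 0 = 0 := by simp [hw, hu, hv]
  have hvu : v ⬝ᵥ u = 0 := by rw [dotProduct_comm, huv]
  have hwu : w ⬝ᵥ u = c := by simp [hw, hu1, hvu]
  have hw1 : w ⬝ᵥ w = 1 := by
    have hI := Complex.I_sq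
    simp only [hw, dotProduct_add, add_dotProduct, smul_dotProduct, dotProduct_smul, hu1, hv1, huv,
      hvu, smul_eq_mul]
    linear_combination hcs + s ^ 2 * hI
  have hvu1 : octL v *ᵥ u = -bv 1 := by rw [octL_mulVec_comm hv hu hvu, h1]
  refine ⟨_, _, ((isSpinLift_octL hw0 hw1).mul (isSpinLift_octL hu hu1)).neg, fun x => ?_, ?_, ?_⟩
  · have h2 : (unitRefl w * octConj) * (unitRefl u * octConj) = unitRefl w * unitRefl u := by
      rw [← octConj_mul_unitRefl hu, Matrix.mul_assoc, ← Matrix.mul_assoc octConj,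
        octConj_mul_self, Matrix.one_mul]
    have hwx : w ⬝ᵥ x = c * (u ⬝ᵥ x) + Complex.I * s * (v ⬝ᵥ x) := by
      rw [hw, add_dotProduct, smul_dotProduct, smul_dotProduct, smul_eq_mul, smul_eq_mul]
    have hI := Complex.I_sq
    rw [h2, ← mulVec_mulVec, unitRefl_mulVec, unitRefl_mulVec, dotProduct_sub, dotProduct_smul,
      hwu, hwx, hw]
    ext i
    simp only [Pi.sub_apply, Pi.add_apply, Pi.smul_apply, smul_eq_mul]
    linear_combination (2 * (u ⬝ᵥ x) * u i) * hcs - 2 * s ^ 2 * (v ⬝ᵥ x) * v i * hI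
  · rw [neg_mulVec, ← mulVec_mulVec, octL_mulVec_one, hw, octL_add, octL_smul, octL_smul,
      add_mulVec, smul_mulVec, smul_mulVec, octL_mulVec_self hu hu1, hvu1]
    simp only [smul_neg]
    abel
  · have h3 : octL u *ᵥ bv 1 = -v := by rw [← h1, octL_mulVec_octL hu hu1]
    rw [neg_mulVec, ← mulVec_mulVec, h3, mulVec_neg, neg_neg, hw, octL_add, octL_smul, octL_smul,
      add_mulVec, smul_mulVec, smul_mulVec, octL_mulVec_self hv hv1, h1]
    simp only [smul_neg]
    abel

theorem amat_mulVec_bv (θ : ℝ) (j : Fin 8) : amat θ *ᵥ bv j = fun i => amat θ i j := by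
  rw [mulVec_single_one]
  rfl

/-- A spin lift of `a_θ`. -/
theorem exists_isSpinLift_amat (t : ℝ) :
    ∃ p, IsSpinLift (amat (2 * t)) p ∧ p *ᵥ bv 0
      = (Real.cosh (3 * t) : ℂ) • bv 0 + (Complex.I * (Real.sinh (3 * t) : ℂ)) • bv 1 := by
  have hcs : (Real.cosh t : ℂ) ^ 2 - (Real.sinh t : ℂ) ^ 2 = 1 := by
    exact_mod_cast Real.cosh_sq_sub_sinh_sq t
  have hc2 : (Real.cosh (2 * t) : ℂ) = 1 + 2 * (Real.sinh t : ℂ) ^ 2 := by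
    have := Real.cosh_two_mul t
    rw [Real.cosh_sq] at this
    rw [this]
    push_cast
    ring
  have hs2 : (Real.sinh (2 * t) : ℂ) = 2 * (Real.sinh t : ℂ) * (Real.cosh t : ℂ) := by
    exact_mod_cast Real.sinh_two_mul t
  have hc3 : (Real.cosh (3 * t) : ℂ) = 4 * (Real.cosh t : ℂ) ^ 3 - 3 * (Real.cosh t : ℂ) := by
    exact_mod_cast Real.cosh_three_mul t
  have hs3 : (Real.sinh (3 * t) : ℂ) = 4 * (Real.sinh t : ℂ) ^ 3 + 3 * (Real.sinh t : ℂ) := by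
    exact_mod_cast Real.sinh_three_mul t
  set c : ℂ := (Real.cosh t : ℂ)
  set s : ℂ := (Real.sinh t : ℂ)
  have hmul : ∀ a b : Fin 8, (a, b) ∈ [((2 : Fin 8), (3 : Fin 8)), (4, 5), (6, 7)] →
      octL (bv a : Fin 8 → ℂ) *ᵥ bv b = bv 1 := by
    intro a b hab
    simp only [List.mem_cons, Prod.mk.injEq, List.not_mem_nil, or_false] at hab
    rcases hab with ⟨rfl, rfl⟩ | ⟨rfl, rfl⟩ | ⟨rfl, rfl⟩ <;> ext i <;> fin_cases i <;> simp [octL]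
  obtain ⟨k₁, p₁, h₁, hk₁, ha₁, hb₁⟩ := exists_isSpinLift_plane (u := bv 2) (v := bv 3)
    (by simp) (by simp) (by simp) (by simp) (by simp) (hmul 2 3 (by simp)) hcs
  obtain ⟨k₂, p₂, h₂, hk₂, ha₂, hb₂⟩ := exists_isSpinLift_plane (u := bv 4) (v := bv 5)
    (by simp) (by simp) (by simp) (by simp) (by simp) (hmul 4 5 (by simp)) hcs
  obtain ⟨k₃, p₃, h₃, hk₃, ha₃, hb₃⟩ := exists_isSpinLift_plane (u := bv 6) (v := bv 7)
    (by simp) (by simp) (by simp) (by simp) (by simp) (hmul 6 7 (by simp)) hcs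
  have hamat : amat (2 * t) = k₁ * k₂ * k₃ := by
    refine Matrix.ext_of_mulVec_single fun j => ?_
    rw [amat_mulVec_bv, ← mulVec_mulVec, ← mulVec_mulVec, hk₃, hk₂, hk₁]
    ext i
    simp only [amat, hc2, hs2, Matrix.of_apply]
    fin_cases j <;> fin_cases i <;> simp [e] <;> ring
  refine ⟨p₁ * p₂ * p₃, hamat ▸ (h₁.mul h₂).mul h₃, ?_⟩
  rw [← mulVec_mulVec, ← mulVec_mulVec, ha₃, mulVec_add, mulVec_smul, mulVec_smul, ha₂, hb₂]
  simp only [mulVec_add, mulVec_sub, mulVec_smul, ha₁, hb₁]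
  have hI := Complex.I_sq
  ext i
  simp only [Pi.sub_apply, Pi.add_apply, Pi.smul_apply, smul_eq_mul, hc3, hs3]
  generalize (bv 0 : Fin 8 → ℂ) i = x
  generalize (bv 1 : Fin 8 → ℂ) i = y
  have hI3 : Complex.I ^ 3 = -Complex.I := Complex.I_pow_three
  linear_combination (3 * c * s ^ 2 * -x - s ^ 3 * Complex.I * y) * hI
    + (-3 * c * x + 3 * s * Complex.I * y) * hcs

end PlaneRotation

theorem inG2_of_isSpinLift {h p : Matrix (Fin 8) (Fin 8) ℂ} (hp : IsSpinLift h p)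
    (hp0 : p *ᵥ bv 0 = bv 0) : inG2 h := by
  have hph : p = h := by
    refine Matrix.ext_of_mulVec_single fun i => ?_
    have h1 := congrArg (· *ᵥ bv 0) (hp.comm (bv i))
    simp only [← mulVec_mulVec, hp0, octL_mulVec_one] at h1
    exact h1.symm
  refine ⟨⟨hp.orth, hp.det⟩, fun x y => ?_⟩
  subst hph
  rw [octMul_eq, octMul_eq, mulVec_mulVec, mulVec_mulVec, hp.comm]

/-- The real spin group moves every point of the complex unit quadric into the standard slice. -/
theorem exists_isSpinLift_mulVec_eq_slice {z : Fin 8 → ℂ} (hz : z ⬝ᵥ z = 1) :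
    ∃ (k q : Matrix (Fin 8) (Fin 8) ℝ) (t : ℝ), IsSpinLift k q ∧
      q.map Complex.ofRealHom *ᵥ z
        = (Real.cosh t : ℂ) • bv 0 + (Complex.I * (Real.sinh t : ℂ)) • bv 1 := by
  set x : Fin 8 → ℝ := fun i => (z i).re with hx
  set y : Fin 8 → ℝ := fun i => (z i).im with hy
  have hre : x ⬝ᵥ x = 1 + y ⬝ᵥ y := by
    have := congrArg Complex.re hz
    simp only [dotProduct, Complex.re_sum, Complex.mul_re, Finset.sum_sub_distrib,
      Complex.one_re] at this
    simp only [dotProduct, hx, hy]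
    linarith
  have him : x ⬝ᵥ y = 0 := by
    have := congrArg Complex.im hz
    simp only [dotProduct, Complex.im_sum, Complex.mul_im, Finset.sum_add_distrib,
      Complex.one_im] at this
    have h2 : ∑ i, (z i).im * (z i).re = ∑ i, (z i).re * (z i).im :=
      Finset.sum_congr rfl fun i _ => mul_comm _ _
    simp only [dotProduct, hx, hy]
    linarith
  have hyy : 0 ≤ y ⬝ᵥ y := by simpa using dotProduct_star_self_nonneg y
  have hr : 0 < √(1 + y ⬝ᵥ y) := Real.sqrt_pos.2 (by linarith)
  set r := √(1 + y ⬝ᵥ y) with hrdef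
  have hrr : r * r = 1 + y ⬝ᵥ y := Real.mul_self_sqrt (by linarith)
  obtain ⟨k₁, q₁, h₁, hu⟩ := exists_isSpinLift_mulVec_eq_one (u := r⁻¹ • x) (by
    rw [dotProduct_smul, smul_dotProduct, hre, ← hrr, smul_eq_mul, smul_eq_mul]
    field_simp)
  have hqx : q₁ *ᵥ x = r • bv 0 := by
    rw [← hu, mulVec_smul, smul_smul, mul_inv_cancel₀ hr.ne', one_smul]
  have hqy : (q₁ *ᵥ y) 0 = 0 := by
    have h2 := mulVec_dotProduct_mulVec h₁.lift_orth x y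
    rw [hqx, him, smul_dotProduct, single_one_dotProduct, smul_eq_mul] at h2
    exact (mul_eq_zero.1 h2).resolve_left hr.ne'
  obtain ⟨k₂, q₂, h₂, h20, h2y⟩ := exists_isSpinLift_mulVec_eq_smul hqy
  rw [mulVec_dotProduct_mulVec h₁.lift_orth] at h2y
  refine ⟨_, _, Real.arsinh √(y ⬝ᵥ y), h₂.mul h₁, ?_⟩
  have hX : (q₂ * q₁) *ᵥ x = r • bv 0 := by rw [← mulVec_mulVec, hqx, mulVec_smul, h20]
  have hY : (q₂ * q₁) *ᵥ y = √(y ⬝ᵥ y) • bv 1 := by rw [← mulVec_mulVec, h2y]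
  have hz' : z = Complex.ofRealHom ∘ x + Complex.I • (Complex.ofRealHom ∘ y) := by
    ext i
    simp [hx, hy, mul_comm Complex.I, Complex.re_add_im]
  have hmap : ∀ a : Fin 8 → ℝ, (q₂ * q₁).map Complex.ofRealHom *ᵥ (Complex.ofRealHom ∘ a)
      = Complex.ofRealHom ∘ ((q₂ * q₁) *ᵥ a) := by
    intro a
    ext i
    exact (RingHom.map_mulVec _ _ _ _).symm
  rw [Real.cosh_arsinh, Real.sinh_arsinh, Real.sq_sqrt hyy, ← hrdef, hz', mulVec_add, mulVec_smul,
    hmap, hmap, hX, hY]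
  ext i
  simp only [Pi.add_apply, Pi.smul_apply, Function.comp_apply, smul_eq_mul, map_mul, mul_assoc,
    Pi.single_apply, apply_ite Complex.ofRealHom, map_one, map_zero, Complex.ofRealHom_eq_coe]

/-- **Theorem `thm:cartan-so7` (Cartan decomposition for Type R-1).**
For the non-symmetric reductive spherical pair `(SO(7,ℂ), G₂(ℂ))` of rank-one type:
every `g ∈ SO(8,ℂ)` fixing `e₀` (i.e. `g` in the realization of `SO(7,ℂ)`) can be
written `g = k a_θ h` with `k ∈ SO(7)` (real entries, fixing `e₀`), `θ ∈ ℝ` and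
`h ∈ G₂(ℂ)`.  That is, `SO(7,ℂ) = SO(7) · A₀ · G₂(ℂ)`. -/
theorem stmt14 (g : Matrix (Fin 8) (Fin 8) ℂ) (hg : SO8 g)
    (hge : g.mulVec (e 0) = e 0) :
    ∃ (k : Matrix (Fin 8) (Fin 8) ℂ) (θ : ℝ) (h : Matrix (Fin 8) (Fin 8) ℂ),
      SO8 k ∧ realMat k ∧ k.mulVec (e 0) = e 0 ∧ inG2 h ∧ g = k * amat θ * h := by
  obtain ⟨p, hp⟩ := exists_isSpinLift hg.1 hg.2 hge
  have hz : (p *ᵥ bv 0) ⬝ᵥ (p *ᵥ bv 0) = 1 := by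
    rw [mulVec_dotProduct_mulVec hp.lift_orth, bv_dotProduct_self]
  obtain ⟨k, q, t, hq, hqz⟩ := exists_isSpinLift_mulVec_eq_slice hz
  obtain ⟨b, hb, hb0⟩ := exists_isSpinLift_amat (t / 3)
  rw [mul_div_cancel₀ t (by norm_num : (3 : ℝ) ≠ 0)] at hb0
  have hk := hq.map Complex.ofRealHom
  have hkT := hk.transpose
  refine ⟨(k.map Complex.ofRealHom)ᵀ, 2 * (t / 3),
    (amat (2 * (t / 3)))ᵀ * (k.map Complex.ofRealHom * g), ⟨hkT.orth, hkT.det⟩,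
    fun i j => by simp, hkT.fix, ?_, ?_⟩
  · refine inG2_of_isSpinLift (hb.transpose.mul (hk.mul hp)) ?_
    rw [← mulVec_mulVec, ← mulVec_mulVec, hqz, ← hb0, mulVec_mulVec, hb.lift_orth, one_mulVec]
  · rw [Matrix.mul_assoc, ← Matrix.mul_assoc (amat _), mul_eq_one_comm.1 hb.orth, Matrix.one_mul,
      ← Matrix.mul_assoc, hk.orth, Matrix.one_mul]
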